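/- arXiv:2205.13432 — 3 statements merged into one kernel-verified Lean document; each statement's English description precedes it below -/
import Mathlib

section
/- Trek rule: for every D-supported Λ, every B-compatible Ω, and all v, w ∈ V, Σ v w = ∑_{i ∈ V} ∑_{j ∈ V} W(i, v) · Ω i j · W(j, w), where W(i, v) denotes the sum over all directed paths from i to v of their weights. (Equivalently, σ_{vw} equals the sum, over all treks from v to w, of the corresponding trek monomials.) -/
open Matrix

attribute [local instance] Classical.propDecidable

namespace EdgeIntervention

variable {n : ℕ}

/-- Descendants of `b` (including `b`): vertices reachable under the edge relation of `D`. -/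
def desc (D : Set (Fin n × Fin n)) (b : Fin n) : Set (Fin n) :=
  {c | Relation.ReflTransGen (fun i j => (i, j) ∈ D) b c}

/-- Ancestors of `c` (including `c`). -/
def anc (D : Set (Fin n × Fin n)) (c : Fin n) : Set (Fin n) :=
  {i | c ∈ desc D i}

/-- Descendants of `b` in the induced subgraph on `W`. -/
def descW (D : Set (Fin n × Fin n)) (W : Set (Fin n)) (b : Fin n) : Set (Fin n) :=
  {c | Relation.ReflTransGen (fun i j => (i, j) ∈ D ∧ i ∈ W ∧ j ∈ W) b c}

/-- District of `b` in the induced subgraph on `W`. -/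
def disW (B : Set (Fin n × Fin n)) (W : Set (Fin n)) (b : Fin n) : Set (Fin n) :=
  {c | Relation.ReflTransGen (fun i j => (i, j) ∈ B ∧ i ∈ W ∧ j ∈ W) b c}

/-- Markov blanket of `b` in the induced subgraph on `W`. -/
def mbW (D B : Set (Fin n × Fin n)) (W : Set (Fin n)) (b : Fin n) : Set (Fin n) :=
  (disW B W b ∪ {i | i ∈ W ∧ ∃ d ∈ disW B W b, (i, d) ∈ D}) \ {b}

/-- `Λ` is supported on the directed edge set `D`. -/
def DSupported (D : Set (Fin n × Fin n)) (Λ : Matrix (Fin n) (Fin n) ℝ) : Prop :=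
  ∀ i j, (i, j) ∉ D → Λ i j = 0

/-- `Ω` is compatible with the bidirected edge set `B`: symmetric, positive definite,
and vanishing off the diagonal and off `B`. -/
def BCompatible (B : Set (Fin n × Fin n)) (Ω : Matrix (Fin n) (Fin n) ℝ) : Prop :=
  Ω.IsSymm ∧ Ω.PosDef ∧ ∀ i j, i ≠ j → (i, j) ∉ B → Ω i j = 0

/-- The covariance matrix `Σ = ((1 - Λ)⁻¹)ᵀ * Ω * (1 - Λ)⁻¹` of the linear SEM. -/
noncomputable def cov (Λ Ω : Matrix (Fin n) (Fin n) ℝ) : Matrix (Fin n) (Fin n) ℝ :=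
  ((1 - Λ)⁻¹)ᵀ * Ω * (1 - Λ)⁻¹

/-- Sum over all directed paths from `i` to `j` of their weights.  A path with `k` edges is
encoded as `f : Fin (k+1) → Fin n` with all steps in `D`; since edges strictly increase,
every directed path has at most `n` edges, so `k` ranges over `Finset.range (n+1)`. -/
noncomputable def pathSum (D : Set (Fin n × Fin n)) (Λ : Matrix (Fin n) (Fin n) ℝ)
    (i j : Fin n) : ℝ :=
  ∑ k ∈ Finset.range (n + 1),
    ∑ f ∈ Finset.univ.filter
        (fun f : Fin (k + 1) → Fin n =>
          f 0 = i ∧ f (Fin.last k) = j ∧ ∀ t : Fin k, (f t.castSucc, f t.succ) ∈ D),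
      ∏ t : Fin k, Λ (f t.castSucc) (f t.succ)

/-- Conditional covariance `σ_{vw·S} = Σ v w − Σ_{vS} (Σ_{SS})⁻¹ Σ_{Sw}`. -/
noncomputable def condCov (Cov : Matrix (Fin n) (Fin n) ℝ) (S : Set (Fin n))
    (v w : Fin n) : ℝ :=
  letI := (Set.toFinite S).fintype
  Cov v w - ∑ i : S, ∑ j : S,
    Cov v i.val * (Cov.submatrix (Subtype.val : S → Fin n) Subtype.val)⁻¹ i j * Cov j.val w

/-- Regression coefficient `β_{vw·S} = σ_{vw·S} / σ_{vv·S}`. -/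
noncomputable def regCoef (Cov : Matrix (Fin n) (Fin n) ℝ) (S : Set (Fin n))
    (v w : Fin n) : ℝ :=
  condCov Cov S v w / condCov Cov S v v

/-- The matrix obtained from `Λ` by setting the `(a,b)` entry to `0`
(removal of the directed edge `a → b`). -/
def removeEdge (Λ : Matrix (Fin n) (Fin n) ℝ) (a b : Fin n) : Matrix (Fin n) (Fin n) ℝ :=
  Matrix.of fun i j => if i = a ∧ j = b then 0 else Λ i j

/-- The matrix obtained from `Ω` by setting the `(a,b)` and `(b,a)` entries to `0`
(removal of the bidirected edge `a ↔ b`). -/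
def removeBi (Ω : Matrix (Fin n) (Fin n) ℝ) (a b : Fin n) : Matrix (Fin n) (Fin n) ℝ :=
  Matrix.of fun i j => if (i = a ∧ j = b) ∨ (i = b ∧ j = a) then 0 else Ω i j

/-- The sum over all length-`k` walks from `i` to `j` is an entry of the `k`-th matrix power. -/
theorem sum_walks_eq_pow_apply (Λ : Matrix (Fin n) (Fin n) ℝ) (k : ℕ) (i j : Fin n) :
    (∑ f : Fin (k + 1) → Fin n, if f 0 = i ∧ f (Fin.last k) = j then
      ∏ t : Fin k, Λ (f t.castSucc) (f t.succ) else 0) = (Λ ^ k) i j := by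
  induction k generalizing i with
  | zero =>
    rw [← (Equiv.funUnique (Fin 1) (Fin n)).symm.sum_comp]
    simp [Matrix.one_apply, ite_and]
  | succ k ih =>
    rw [← (Fin.consEquiv fun _ => Fin n).sum_comp, Fintype.sum_prod_type, pow_succ',
      Matrix.mul_apply]
    simp_rw [← ih, Finset.mul_sum]
    rw [Finset.sum_comm, Finset.sum_comm (s := Finset.univ (α := Fin n))]
    refine Finset.sum_congr rfl fun f _ => ?_
    have hlast (x : Fin n) :
        Fin.cons (α := fun _ => Fin n) x f (Fin.last (k + 1)) = f (Fin.last k) := by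
      rw [← Fin.succ_last, Fin.cons_succ]
    simp [Fin.consEquiv, Fin.prod_univ_succ, hlast, ite_and]

theorem pathSum_eq_sum_pow_apply {D : Set (Fin n × Fin n)} {Λ : Matrix (Fin n) (Fin n) ℝ}
    (hΛ : DSupported D Λ) (i j : Fin n) :
    pathSum D Λ i j = (∑ k ∈ Finset.range (n + 1), Λ ^ k) i j := by
  rw [Matrix.sum_apply]
  refine Finset.sum_congr rfl fun k _ => ?_
  rw [← sum_walks_eq_pow_apply, Finset.sum_filter]
  refine Finset.sum_congr rfl fun f _ => ?_
  by_cases hf : ∀ t : Fin k, (f t.castSucc, f t.succ) ∈ D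
  · simp [hf]
  · obtain ⟨t, ht⟩ := not_forall.mp hf
    have hprod : ∏ t : Fin k, Λ (f t.castSucc) (f t.succ) = 0 :=
      Finset.prod_eq_zero (Finset.mem_univ t) (hΛ _ _ ht)
    simp [hprod]

/-- Powers of a strictly upper triangular matrix vanish below the corresponding superdiagonal. -/
theorem pow_apply_eq_zero_of_lt_add {Λ : Matrix (Fin n) (Fin n) ℝ}
    (hΛ : ∀ i j : Fin n, j ≤ i → Λ i j = 0) (k : ℕ) (i j : Fin n) (hij : (j : ℕ) < i + k) :
    (Λ ^ k) i j = 0 := by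
  induction k generalizing i with
  | zero => exact Matrix.one_apply_ne (by rintro rfl; omega)
  | succ k ih =>
    rw [pow_succ', Matrix.mul_apply]
    refine Finset.sum_eq_zero fun l _ => ?_
    rcases le_or_gt l i with hl | hl
    · rw [hΛ i l hl, zero_mul]
    · rw [ih l (by rw [Fin.lt_def] at hl; omega), mul_zero]

theorem inv_one_sub_eq_sum_pow {Λ : Matrix (Fin n) (Fin n) ℝ}
    (hΛ : ∀ i j : Fin n, j ≤ i → Λ i j = 0) :
    (1 - Λ)⁻¹ = ∑ k ∈ Finset.range (n + 1), Λ ^ k := by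
  have hnil : Λ ^ (n + 1) = 0 := by
    ext i j
    exact pow_apply_eq_zero_of_lt_add hΛ _ i j (by omega)
  refine Matrix.inv_eq_left_inv ?_
  rw [geom_sum_mul_neg, hnil, sub_zero]

/-- Trek rule: `Σ v w = ∑ i ∑ j W(i,v) · Ω i j · W(j,w)` where `W(i,v)` is the
sum over all directed paths from `i` to `v` of their weights. -/
theorem trek_rule (n : ℕ) (D B : Set (Fin n × Fin n))
    (hD : ∀ i j : Fin n, (i, j) ∈ D → i < j)
    (hBsymm : ∀ i j : Fin n, (i, j) ∈ B → (j, i) ∈ B)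
    (hBirr : ∀ i : Fin n, (i, i) ∉ B)
    (Λ Ω : Matrix (Fin n) (Fin n) ℝ)
    (hΛ : DSupported D Λ) (hΩ : BCompatible B Ω) :
    ∀ v w : Fin n,
      cov Λ Ω v w = ∑ i : Fin n, ∑ j : Fin n, pathSum D Λ i v * Ω i j * pathSum D Λ j w := by
  intro v w
  have hupper (i j : Fin n) (hij : j ≤ i) : Λ i j = 0 :=
    hΛ i j fun h => (hD i j h).not_ge hij
  simp_rw [cov, inv_one_sub_eq_sum_pow hupper, Matrix.mul_apply, Matrix.transpose_apply,
    ← pathSum_eq_sum_pow_apply hΛ, Finset.sum_mul]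
  exact Finset.sum_comm

end EdgeIntervention
end

section
/- After removing the directed edge a⋆ → b, for every a ∈ nd(b) one has Σ⋆ a b = Σ a b − Σ a a⋆ · λ. -/
open Matrix

attribute [local instance] Classical.propDecidable

namespace EdgeIntervention

variable {n : ℕ}

theorem le_of_mem_desc {D : Set (Fin n × Fin n)} (hD : ∀ i j : Fin n, (i, j) ∈ D → i < j)
    {b c : Fin n} (hc : c ∈ desc D b) : b ≤ c := by
  induction hc with
  | refl => exact le_rfl
  | tail _ h ih => exact ih.trans (hD _ _ h).le

theorem det_one_sub_eq_one {D : Set (Fin n × Fin n)}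
    (hD : ∀ i j : Fin n, (i, j) ∈ D → i < j) {Λ : Matrix (Fin n) (Fin n) ℝ}
    (hΛ : DSupported D Λ) : (1 - Λ).det = 1 := by
  have hzero : ∀ i j, j ≤ i → Λ i j = 0 := fun i j hij =>
    hΛ i j fun h => (hD i j h).not_ge hij
  rw [Matrix.det_of_isUpperTriangular]
  · exact Finset.prod_eq_one fun i _ => by simp [hzero i i le_rfl]
  · intro i j hij
    have hij : j < i := hij
    simp [Matrix.one_apply_ne hij.ne', hzero i j hij.le]

theorem isUnit_det_one_sub {D : Set (Fin n × Fin n)}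
    (hD : ∀ i j : Fin n, (i, j) ∈ D → i < j) {Λ : Matrix (Fin n) (Fin n) ℝ}
    (hΛ : DSupported D Λ) : IsUnit (1 - Λ).det := by
  rw [det_one_sub_eq_one hD hΛ]
  exact isUnit_one

theorem inv_one_sub_apply {D : Set (Fin n × Fin n)}
    (hD : ∀ i j : Fin n, (i, j) ∈ D → i < j) {Λ : Matrix (Fin n) (Fin n) ℝ}
    (hΛ : DSupported D Λ) (i j : Fin n) :
    (1 - Λ)⁻¹ i j = (1 : Matrix (Fin n) (Fin n) ℝ) i j + ∑ k, (1 - Λ)⁻¹ i k * Λ k j := by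
  have h := Matrix.nonsing_inv_mul (1 - Λ) (isUnit_det_one_sub hD hΛ)
  rw [mul_sub, mul_one, sub_eq_iff_eq_add] at h
  simpa only [Matrix.add_apply, Matrix.mul_apply] using congrFun (congrFun h i) j

theorem inv_one_sub_apply_eq_zero {D : Set (Fin n × Fin n)}
    (hD : ∀ i j : Fin n, (i, j) ∈ D → i < j) {Λ : Matrix (Fin n) (Fin n) ℝ}
    (hΛ : DSupported D Λ) (b j : Fin n) (hj : j ∉ desc D b) : (1 - Λ)⁻¹ b j = 0 := by
  induction j using WellFoundedLT.induction with
  | ind j ih =>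
    have hbj : b ≠ j := by
      rintro rfl
      exact hj Relation.ReflTransGen.refl
    rw [inv_one_sub_apply hD hΛ, Matrix.one_apply_ne hbj, zero_add]
    refine Finset.sum_eq_zero fun k _ => ?_
    by_cases hk : (k, j) ∈ D
    · rw [ih k (hD k j hk) fun h => hj (Relation.ReflTransGen.tail h hk), zero_mul]
    · rw [hΛ k j hk, mul_zero]

theorem inv_one_sub_apply_self {D : Set (Fin n × Fin n)}
    (hD : ∀ i j : Fin n, (i, j) ∈ D → i < j) {Λ : Matrix (Fin n) (Fin n) ℝ}
    (hΛ : DSupported D Λ) (b : Fin n) : (1 - Λ)⁻¹ b b = 1 := by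
  rw [inv_one_sub_apply hD hΛ, Matrix.one_apply_eq, add_eq_left]
  refine Finset.sum_eq_zero fun k _ => ?_
  by_cases hk : (k, b) ∈ D
  · rw [inv_one_sub_apply_eq_zero hD hΛ b k fun h =>
      (hD k b hk).not_ge (le_of_mem_desc hD h), zero_mul]
  · rw [hΛ k b hk, mul_zero]

theorem DSupported.removeEdge {D : Set (Fin n × Fin n)} {Λ : Matrix (Fin n) (Fin n) ℝ}
    (hΛ : DSupported D Λ) (a b : Fin n) : DSupported D (removeEdge Λ a b) := by
  intro i j hij
  simp [EdgeIntervention.removeEdge, hΛ i j hij]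

theorem sub_removeEdge (Λ : Matrix (Fin n) (Fin n) ℝ) (a b : Fin n) :
    Λ - removeEdge Λ a b = Matrix.single a b (Λ a b) := by
  ext i j
  by_cases h : i = a ∧ j = b
  · obtain ⟨rfl, rfl⟩ := h
    simp [removeEdge]
  · have h' : ¬(a = i ∧ b = j) := fun h' => h ⟨h'.1.symm, h'.2.symm⟩
    simp [removeEdge, h, h']

theorem inv_one_sub_removeEdge_apply {D : Set (Fin n × Fin n)}
    (hD : ∀ i j : Fin n, (i, j) ∈ D → i < j) {Λ : Matrix (Fin n) (Fin n) ℝ}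
    (hΛ : DSupported D Λ) (a b i j : Fin n) :
    (1 - removeEdge Λ a b)⁻¹ i j =
      (1 - Λ)⁻¹ i j - (1 - removeEdge Λ a b)⁻¹ i a * Λ a b * (1 - Λ)⁻¹ b j := by
  have h₁ := Matrix.nonsing_inv_mul _ (isUnit_det_one_sub hD (hΛ.removeEdge a b))
  have h₂ := Matrix.mul_nonsing_inv _ (isUnit_det_one_sub hD hΛ)
  have h : (1 - Λ)⁻¹ - (1 - removeEdge Λ a b)⁻¹ =
      (1 - removeEdge Λ a b)⁻¹ * Matrix.single a b (Λ a b) * (1 - Λ)⁻¹ := by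
    rw [← sub_removeEdge,
      ← sub_sub_sub_cancel_left (removeEdge Λ a b) Λ (1 : Matrix (Fin n) (Fin n) ℝ), mul_sub,
      sub_mul, h₁, one_mul, mul_assoc, h₂, mul_one]
  have hij := congrFun (congrFun h i) j
  rw [Matrix.sub_apply, mul_assoc, Matrix.mul_apply, Finset.sum_eq_single a] at hij
  · rw [Matrix.single_mul_apply_same] at hij
    linarith
  · intro k _ hk
    rw [Matrix.single_mul_apply_of_ne _ _ _ _ _ hk, mul_zero]
  · simp

theorem inv_one_sub_removeEdge_apply_of_notMem_desc {D : Set (Fin n × Fin n)}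
    (hD : ∀ i j : Fin n, (i, j) ∈ D → i < j) {Λ : Matrix (Fin n) (Fin n) ℝ}
    (hΛ : DSupported D Λ) (a b i : Fin n) {j : Fin n} (hj : j ∉ desc D b) :
    (1 - removeEdge Λ a b)⁻¹ i j = (1 - Λ)⁻¹ i j := by
  rw [inv_one_sub_removeEdge_apply hD hΛ, inv_one_sub_apply_eq_zero hD hΛ b j hj, mul_zero,
    sub_zero]

theorem inv_one_sub_removeEdge_apply_head {D : Set (Fin n × Fin n)}
    (hD : ∀ i j : Fin n, (i, j) ∈ D → i < j) {Λ : Matrix (Fin n) (Fin n) ℝ}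
    (hΛ : DSupported D Λ) {a b : Fin n} (hab : (a, b) ∈ D) (i : Fin n) :
    (1 - removeEdge Λ a b)⁻¹ i b = (1 - Λ)⁻¹ i b - (1 - Λ)⁻¹ i a * Λ a b := by
  have ha : a ∉ desc D b := fun h => (hD a b hab).not_ge (le_of_mem_desc hD h)
  rw [inv_one_sub_removeEdge_apply hD hΛ, inv_one_sub_apply_self hD hΛ, mul_one,
    inv_one_sub_removeEdge_apply_of_notMem_desc hD hΛ a b i ha]

/-- after removing the directed edge `a⋆ → b`, for every `a ∈ nd(b)` one has
`Σ⋆ a b = Σ a b − Σ a a⋆ · λ`. -/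
theorem remove_edge_cov_a_b (n : ℕ) (D B : Set (Fin n × Fin n))
    (hD : ∀ i j : Fin n, (i, j) ∈ D → i < j)
    (hBsymm : ∀ i j : Fin n, (i, j) ∈ B → (j, i) ∈ B)
    (hBirr : ∀ i : Fin n, (i, i) ∉ B)
    (Λ Ω : Matrix (Fin n) (Fin n) ℝ)
    (hΛ : DSupported D Λ) (hΩ : BCompatible B Ω)
    (astar b : Fin n) (hab : (astar, b) ∈ D) :
    ∀ a : Fin n, a ∉ desc D b →
      cov (removeEdge Λ astar b) Ω a b = cov Λ Ω a b - cov Λ Ω a astar * Λ astar b := by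
  intro a ha
  simp only [cov, Matrix.mul_apply, Matrix.transpose_apply,
    inv_one_sub_removeEdge_apply_of_notMem_desc hD hΛ astar b _ ha,
    inv_one_sub_removeEdge_apply_head hD hΛ hab, mul_sub, Finset.sum_sub_distrib, ← mul_assoc,
    ← Finset.sum_mul]

end EdgeIntervention
end

section
/- Verma constraint: let n = 4 with vertices 1, 2, 3, 4 (identified with Fin 4 via 0, 1, 2, 3), D = {(1,2), (2,3), (3,4), (1,3)} and B = {(2,4), (4,2)}. Then for every D-supported Λ and B-compatible Ω, writing σ_{ij} for the entries of Σ = ((1 − Λ)⁻¹)ᵀ * Ω * (1 − Λ)⁻¹, one has σ₁₁σ₁₃σ₂₂σ₃₄ − σ₁₂²σ₁₃σ₃₄ − σ₁₁σ₁₄σ₂₂σ₃₃ + σ₁₂²σ₁₄σ₃₃ − σ₁₁σ₁₃σ₂₃σ₂₄ + σ₁₁σ₁₄σ₂₃² + σ₁₂σ₁₃²σ₂₄ − σ₁₂σ₁₃σ₁₄σ₂₃ = 0. -/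
open Matrix

attribute [local instance] Classical.propDecidable

namespace EdgeIntervention

variable {n : ℕ}

/-- The inverse of `1 - Λ` for the Verma graph, whose entries are the path sums. -/
theorem inv_one_sub_verma (Λ : Matrix (Fin 4) (Fin 4) ℝ)
    (hΛ : DSupported ({(0, 1), (1, 2), (2, 3), (0, 2)} : Set (Fin 4 × Fin 4)) Λ) :
    (1 - Λ)⁻¹ = !![1, Λ 0 1, Λ 0 1 * Λ 1 2 + Λ 0 2, (Λ 0 1 * Λ 1 2 + Λ 0 2) * Λ 2 3;
      0, 1, Λ 1 2, Λ 1 2 * Λ 2 3;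
      0, 0, 1, Λ 2 3;
      0, 0, 0, 1] := by
  apply Matrix.inv_eq_right_inv
  have h : Λ = !![0, Λ 0 1, Λ 0 2, 0; 0, 0, Λ 1 2, 0; 0, 0, 0, Λ 2 3; 0, 0, 0, 0] := by
    ext i j
    fin_cases i <;> fin_cases j <;> first | rfl | exact hΛ _ _ (by simp)
  generalize Λ 0 1 = a at *
  generalize Λ 0 2 = d at *
  generalize Λ 1 2 = b at *
  generalize Λ 2 3 = c at *
  subst h
  ext i j
  fin_cases i <;> fin_cases j <;>
    simp [Matrix.mul_apply, Fin.sum_univ_four, Matrix.one_apply]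
  ring

/-- Verma constraint: for the Verma graph, with vertices `1,2,3,4` identified
with `0,1,2,3 : Fin 4`, directed edges `1→2, 2→3, 3→4, 1→3` and bidirected edge `2↔4`, every
covariance matrix `Σ` of the model satisfies the Verma polynomial constraint. -/
theorem verma_constraint
    (Λ Ω : Matrix (Fin 4) (Fin 4) ℝ)
    (hΛ : DSupported ({(0, 1), (1, 2), (2, 3), (0, 2)} : Set (Fin 4 × Fin 4)) Λ)
    (hΩ : BCompatible ({(1, 3), (3, 1)} : Set (Fin 4 × Fin 4)) Ω) :
    cov Λ Ω 0 0 * cov Λ Ω 0 2 * cov Λ Ω 1 1 * cov Λ Ω 2 3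
      - (cov Λ Ω 0 1) ^ 2 * cov Λ Ω 0 2 * cov Λ Ω 2 3
      - cov Λ Ω 0 0 * cov Λ Ω 0 3 * cov Λ Ω 1 1 * cov Λ Ω 2 2
      + (cov Λ Ω 0 1) ^ 2 * cov Λ Ω 0 3 * cov Λ Ω 2 2
      - cov Λ Ω 0 0 * cov Λ Ω 0 2 * cov Λ Ω 1 2 * cov Λ Ω 1 3
      + cov Λ Ω 0 0 * cov Λ Ω 0 3 * (cov Λ Ω 1 2) ^ 2
      + cov Λ Ω 0 1 * (cov Λ Ω 0 2) ^ 2 * cov Λ Ω 1 3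
      - cov Λ Ω 0 1 * cov Λ Ω 0 2 * cov Λ Ω 0 3 * cov Λ Ω 1 2 = 0 := by
  obtain ⟨hsymm, -, hzero⟩ := hΩ
  have h01 : Ω 0 1 = 0 := hzero _ _ (by decide) (by simp)
  have h02 : Ω 0 2 = 0 := hzero _ _ (by decide) (by simp)
  have h03 : Ω 0 3 = 0 := hzero _ _ (by decide) (by simp)
  have h12 : Ω 1 2 = 0 := hzero _ _ (by decide) (by simp)
  have h23 : Ω 2 3 = 0 := hzero _ _ (by decide) (by simp)
  have h10 : Ω 1 0 = 0 := (hsymm.apply 0 1).trans h01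
  have h20 : Ω 2 0 = 0 := (hsymm.apply 0 2).trans h02
  have h21 : Ω 2 1 = 0 := (hsymm.apply 1 2).trans h12
  simp only [cov, inv_one_sub_verma Λ hΛ]
  simp [Matrix.mul_apply, Fin.sum_univ_four, h01, h02, h03, h12, h23, h10, h20, h21]
  ring

end EdgeIntervention
end
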